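/- For every function y : ℝ^N → ℝ, every reference point c ∈ ℝ^N, every x ∈ ℝ^N, and every integer 0 ≤ S < N, the recursive truncated RDD equals the direct form: Σ_{u: |u| ≤ S} y_{u,R}(x; c) = Σ_{k=0}^{S} (−1)^k C(N−S+k−1, k) Σ_{u: |u| = S−k} y(x_u, c_{−u}), where C(·,·) denotes the binomial coefficient and the inner sums are over subsets u ⊆ {1,…,N} of the indicated cardinality. -/

import Mathlib

open MeasureTheory Finset

noncomputable def combine {N : ℕ} (v : Finset (Fin N)) (x z : Fin N → ℝ) : Fin N → ℝ :=
  fun i => if i ∈ v then x i else z i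

noncomputable def addComp {N : ℕ} (μ : Measure (Fin N → ℝ)) (y : (Fin N → ℝ) → ℝ)
    (u : Finset (Fin N)) (x : Fin N → ℝ) : ℝ :=
  ∑ v ∈ u.powerset, (-1 : ℝ) ^ (u.card - v.card) * ∫ z, y (combine v x z) ∂μ

noncomputable def rddComp {N : ℕ} (y : (Fin N → ℝ) → ℝ)
    (u : Finset (Fin N)) (x c : Fin N → ℝ) : ℝ :=
  ∑ v ∈ u.powerset, (-1 : ℝ) ^ (u.card - v.card) * y (combine v x c)

noncomputable def addApprox {N : ℕ} (μ : Measure (Fin N → ℝ)) (y : (Fin N → ℝ) → ℝ)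
    (S : ℕ) (x : Fin N → ℝ) : ℝ :=
  ∑ u ∈ Finset.univ.filter (fun u : Finset (Fin N) => u.card ≤ S), addComp μ y u x

noncomputable def rddApprox {N : ℕ} (y : (Fin N → ℝ) → ℝ)
    (S : ℕ) (x c : Fin N → ℝ) : ℝ :=
  ∑ u ∈ Finset.univ.filter (fun u : Finset (Fin N) => u.card ≤ S), rddComp y u x c

noncomputable def addErr {N : ℕ} (μ : Measure (Fin N → ℝ)) (y : (Fin N → ℝ) → ℝ) (S : ℕ) : ℝ :=
  ∫ x, (y x - addApprox μ y S x) ^ 2 ∂μ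

noncomputable def rddErr {N : ℕ} (μ : Measure (Fin N → ℝ)) (y : (Fin N → ℝ) → ℝ)
    (S : ℕ) (c : Fin N → ℝ) : ℝ :=
  ∫ x, (y x - rddApprox y S x c) ^ 2 ∂μ

noncomputable def sigmaSq {N : ℕ} (μ : Measure (Fin N → ℝ)) (y : (Fin N → ℝ) → ℝ)
    (u : Finset (Fin N)) : ℝ :=
  ∫ x, (addComp μ y u x) ^ 2 ∂μ

theorem sum_neg_one_pow_card_superset {α : Type*} [Fintype α] [DecidableEq α] {S : ℕ}
    (hS : S < Fintype.card α) (v : Finset α) (hv : v.card ≤ S) :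
    ∑ u : Finset α with u.card ≤ S ∧ v ⊆ u, (-1 : ℝ) ^ (u.card - v.card) =
      (-1) ^ (S - v.card) * (Nat.choose (Fintype.card α - v.card - 1) (S - v.card) : ℝ) := by
  have hshift : ∑ u : Finset α with u.card ≤ S ∧ v ⊆ u, (-1 : ℝ) ^ (u.card - v.card) =
      ∑ w ∈ vᶜ.powerset with w.card ≤ S - v.card, (-1 : ℝ) ^ w.card := by
    refine Finset.sum_nbij' (fun u => u \ v) (fun w => v ∪ w) ?_ ?_ ?_ ?_ ?_
    · intro u hu
      simp only [mem_filter, mem_univ, true_and, mem_powerset] at hu ⊢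
      refine ⟨fun i hi => by simp_all, ?_⟩
      rw [card_sdiff_of_subset hu.2]
      omega
    · intro w hw
      simp only [mem_filter, mem_univ, true_and, mem_powerset] at hw ⊢
      have := card_union_le v w
      exact ⟨by omega, subset_union_left⟩
    · intro u hu
      simp only [mem_filter, mem_univ, true_and] at hu
      exact union_sdiff_of_subset hu.2
    · intro w hw
      simp only [mem_filter, mem_powerset] at hw
      exact union_sdiff_cancel_left (disjoint_left.2 fun i hi hw' => mem_compl.1 (hw.1 hw') hi)
    · intro u hu
      simp only [mem_filter, mem_univ, true_and] at hu
      rw [card_sdiff_of_subset hu.2]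
  have hrange : (range (vᶜ.card + 1)).filter (fun j => j ≤ S - v.card) =
      range (S - v.card + 1) := by
    ext j
    simp only [mem_filter, mem_range, card_compl]
    omega
  have halt := congrArg (Int.cast : ℤ → ℝ) (Int.alternating_sum_range_choose_eq_choose
    (n := Fintype.card α - v.card - 1) (m := S - v.card))
  rw [show Fintype.card α - v.card - 1 + 1 = Fintype.card α - v.card by omega] at halt
  push_cast at halt
  rw [hshift, sum_filter,
    sum_powerset_apply_card (fun j => if j ≤ S - v.card then (-1 : ℝ) ^ j else 0), ← halt,
    ← hrange, sum_filter]
  refine sum_congr rfl fun j _ => ?_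
  split_ifs <;> simp [card_compl, mul_comm]

theorem rdd_truncation_direct_form {N : ℕ} (hN : 1 ≤ N) (y : (Fin N → ℝ) → ℝ)
    (c x : Fin N → ℝ) (S : ℕ) (hS : S < N) :
    ∑ u ∈ Finset.univ.filter (fun u : Finset (Fin N) => u.card ≤ S), rddComp y u x c =
      ∑ k ∈ Finset.range (S + 1), (-1 : ℝ) ^ k * (Nat.choose (N - S + k - 1) k : ℝ) *
        ∑ u ∈ Finset.univ.filter (fun u : Finset (Fin N) => u.card = S - k), y (combine u x c) := by
  have hswap : ∑ u : Finset (Fin N) with u.card ≤ S, rddComp y u x c =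
      ∑ v : Finset (Fin N) with v.card ≤ S,
        (∑ u : Finset (Fin N) with u.card ≤ S ∧ v ⊆ u, (-1 : ℝ) ^ (u.card - v.card)) *
          y (combine v x c) := by
    simp only [rddComp, sum_mul]
    refine sum_comm' fun u v => ?_
    simp only [mem_filter, mem_univ, true_and, mem_powerset]
    exact ⟨fun h => ⟨h, (card_le_card h.2).trans h.1⟩, fun h => h.1⟩
  have hmaps : ∀ v ∈ (univ : Finset (Finset (Fin N))).filter (fun v => v.card ≤ S),
      S - v.card ∈ range (S + 1) := fun v _ => mem_range.2 (by omega)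
  rw [hswap, ← sum_fiberwise_of_maps_to hmaps]
  refine sum_congr rfl fun k hk => ?_
  rw [mem_range] at hk
  rw [mul_sum, filter_filter]
  refine sum_congr (filter_congr fun v _ => by omega) fun v hv => ?_
  have hv' := (mem_filter.1 hv).2
  rw [sum_neg_one_pow_card_superset (by simpa using hS) v (by omega), Fintype.card_fin,
    show N - v.card - 1 = N - S + k - 1 by omega, show S - v.card = k by omega]
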